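/- arXiv:2411.13266 — 3 statements merged into one kernel-verified Lean document; each statement's English description precedes it below -/
import Mathlib

section
/- Let β < −1, T > 0 and λ ≥ 0. Let f : ℝ → ℝ be continuous and suppose there is M > 0 with |f(x)| ≤ M(1+|x|) for all x ∈ ℝ and |f(x) − f(y)| ≤ M |log|x−y||^β whenever 0 < |x−y| < 1/2. Define u(t,x) := ∫_0^t e^{−λ(t−r)} ∫_ℝ (2π(t−r))^{−1/2} exp(−(x−y)²/(2(t−r))) f(y) dy dr for (t,x) ∈ (0,T]×ℝ and u(0,x) := 0. Then there exists a constant C > 0 such that for every t ∈ [0,T]: (i) sup_x |u(t,x)|/(1+|x|) + sup_x |∂_x u(t,x)| + sup_x |∂²_x u(t,x)| + sup_x |∂_t u(t,x)|/(1+|x|) ≤ C; (ii) |∂²_x u(t,x) − ∂²_x u(t,y)| ≤ C |log|x−y||^β for all x,y with 0 < |x−y| < 1/2; and (iii) |∂_t u(t,x) − ∂_t u(t,y)| ≤ C |log|x−y||^β for all x,y with 0 < |x−y| < 1/2. -/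
open MeasureTheory Set intervalIntegral
open ProbabilityTheory Filter Topology

/-- Continuous functions of at most exponential growth. -/
def HasExpGrowth (h : ℝ → ℝ) (K : ℝ) : Prop :=
  Continuous h ∧ ∀ y, |h y| ≤ K * Real.exp |y|

/-- The heat semigroup at time `σ ^ 2`, as an average over a standard Gaussian. -/
noncomputable def gaussAvg (h : ℝ → ℝ) (x σ : ℝ) : ℝ :=
  ∫ z, h (x + σ * z) ∂(gaussianReal 0 1)

lemma integrable_exp_mul_abs_gaussian (c : ℝ) :
    Integrable (fun z : ℝ => Real.exp (c * |z|)) (gaussianReal 0 1) :=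
  integrable_exp_mul_abs (X := fun z : ℝ => z) (integrable_exp_mul_gaussianReal c)
    (integrable_exp_mul_gaussianReal (-c))

lemma integrable_abs_mul_exp_gaussian (c : ℝ) :
    Integrable (fun z : ℝ => |z| * Real.exp (c * |z|)) (gaussianReal 0 1) := by
  refine (integrable_exp_mul_abs_gaussian (c + 1)).mono' (by fun_prop) (ae_of_all _ fun z => ?_)
  rw [Real.norm_eq_abs, abs_mul, abs_abs, Real.abs_exp, add_mul, one_mul, Real.exp_add, mul_comm]
  have := Real.add_one_le_exp |z|
  gcongr
  linarith

namespace HasExpGrowth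

variable {h h' h'' : ℝ → ℝ} {K K' K'' : ℝ}

lemma nonneg (hh : HasExpGrowth h K) : 0 ≤ K := by
  have := (abs_nonneg _).trans (hh.2 0)
  simpa using this

lemma norm_comp_le (hh : HasExpGrowth h K) {x σ a b : ℝ} (hx : |x| ≤ a) (hσ : |σ| ≤ b) (z : ℝ) :
    ‖h (x + σ * z)‖ ≤ K * Real.exp a * Real.exp (b * |z|) := by
  refine (hh.2 _).trans ?_
  rw [mul_assoc, ← Real.exp_add]
  have := hh.nonneg
  gcongr
  refine (abs_add_le _ _).trans ?_
  rw [abs_mul]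
  gcongr

lemma integrable_comp (hh : HasExpGrowth h K) (x σ : ℝ) :
    Integrable (fun z => h (x + σ * z)) (gaussianReal 0 1) := by
  have := hh.1
  exact ((integrable_exp_mul_abs_gaussian |σ|).const_mul _).mono'
    (by fun_prop) (ae_of_all _ (hh.norm_comp_le le_rfl le_rfl))

lemma integrable_mul_comp (hh : HasExpGrowth h K) (x σ : ℝ) :
    Integrable (fun z => z * h (x + σ * z)) (gaussianReal 0 1) := by
  have := hh.1
  refine ((integrable_abs_mul_exp_gaussian |σ|).const_mul (K * Real.exp |x|)).mono'
    (by fun_prop) (ae_of_all _ fun z => ?_)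
  rw [norm_mul, mul_left_comm, Real.norm_eq_abs z]
  gcongr
  exact hh.norm_comp_le le_rfl le_rfl z

lemma continuous_gaussAvg (hh : HasExpGrowth h K) :
    Continuous (fun p : ℝ × ℝ => gaussAvg h p.1 p.2) := by
  have hc := hh.1
  refine continuous_iff_continuousAt.2 fun p => ?_
  refine continuousAt_of_dominated
    (bound := fun z => K * Real.exp (|p.1| + 1) * Real.exp ((|p.2| + 1) * |z|))
    (Eventually.of_forall fun q => by fun_prop) ?_
    ((integrable_exp_mul_abs_gaussian _).const_mul _)
    (ae_of_all _ fun z => by fun_prop)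
  have h1 : ∀ᶠ q : ℝ × ℝ in 𝓝 p, |q.1| < |p.1| + 1 :=
    (continuous_fst.abs.tendsto p).eventually_lt_const (by simp)
  have h2 : ∀ᶠ q : ℝ × ℝ in 𝓝 p, |q.2| < |p.2| + 1 :=
    (continuous_snd.abs.tendsto p).eventually_lt_const (by simp)
  filter_upwards [h1, h2] with q hq1 hq2
  exact ae_of_all _ fun z => hh.norm_comp_le hq1.le hq2.le z

lemma hasDerivAt_gaussAvg_space (hh : HasExpGrowth h K) (hh' : HasExpGrowth h' K')
    (hd : ∀ y, HasDerivAt h (h' y) y) (x σ : ℝ) :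
    HasDerivAt (fun y => gaussAvg h y σ) (gaussAvg h' x σ) x := by
  have hc := hh.1
  have hc' := hh'.1
  have hs : {y : ℝ | |y| < |x| + 1} ∈ 𝓝 x :=
    (continuous_abs.tendsto x).eventually_lt_const (by simp)
  refine (hasDerivAt_integral_of_dominated_loc_of_deriv_le (F' := fun y z => h' (y + σ * z))
    (bound := fun z => K' * Real.exp (|x| + 1) * Real.exp (|σ| * |z|)) hs
    (Eventually.of_forall fun y => by fun_prop) (hh.integrable_comp x σ) (by fun_prop)
    (ae_of_all _ fun z y hy => hh'.norm_comp_le (le_of_lt hy) le_rfl z)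
    ((integrable_exp_mul_abs_gaussian _).const_mul _) (ae_of_all _ fun z y _ => ?_)).2
  exact (hd _).comp_add_const y (σ * z)

lemma hasDerivAt_gaussAvg_scale (hh : HasExpGrowth h K) (hh' : HasExpGrowth h' K')
    (hd : ∀ y, HasDerivAt h (h' y) y) (x σ : ℝ) :
    HasDerivAt (fun s => gaussAvg h x s)
      (∫ z, z * h' (x + σ * z) ∂(gaussianReal 0 1)) σ := by
  have hc := hh.1
  have hc' := hh'.1
  have hs : {y : ℝ | |y| < |σ| + 1} ∈ 𝓝 σ :=
    (continuous_abs.tendsto σ).eventually_lt_const (by simp)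
  refine (hasDerivAt_integral_of_dominated_loc_of_deriv_le (F' := fun s z => z * h' (x + s * z))
    (bound := fun z => K' * Real.exp |x| * (|z| * Real.exp ((|σ| + 1) * |z|))) hs
    (Eventually.of_forall fun y => by fun_prop) (hh.integrable_comp x σ) (by fun_prop)
    (ae_of_all _ fun z y hy => ?_)
    ((integrable_abs_mul_exp_gaussian _).const_mul _) (ae_of_all _ fun z y _ => ?_)).2
  · rw [norm_mul, mul_left_comm, Real.norm_eq_abs z]
    gcongr
    exact hh'.norm_comp_le le_rfl (le_of_lt hy) z
  · have h1 : HasDerivAt (fun s : ℝ => x + s * z) z y := by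
      simpa using ((hasDerivAt_id y).mul_const z).const_add x
    rw [mul_comm]
    exact (hd _).comp y h1

/-- Gaussian integration by parts. -/
lemma integral_mul_comp_eq (hh : HasExpGrowth h K) (hh' : HasExpGrowth h' K')
    (hd : ∀ y, HasDerivAt h (h' y) y) (x σ : ℝ) :
    ∫ z, z * h (x + σ * z) ∂(gaussianReal 0 1) = σ * gaussAvg h' x σ := by
  have hpdf : ∀ {g : ℝ → ℝ}, Integrable g (gaussianReal 0 1) →
      Integrable (fun z => gaussianPDFReal 0 1 z * g z) := by
    intro g hg
    rw [gaussianReal_of_var_ne_zero 0 one_ne_zero,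
      integrable_withDensity_iff_integrable_smul' (measurable_gaussianPDF _ _)
        (ae_of_all _ fun _ => gaussianPDF_lt_top)] at hg
    simpa [toReal_gaussianPDF] using hg
  have hder : ∀ z, HasDerivAt (gaussianPDFReal 0 1) (gaussianPDFReal 0 1 z * (-z)) z := by
    intro z
    rw [gaussianPDFReal_def]
    have h1 : HasDerivAt (fun y : ℝ => -(y - 0) ^ 2 / (2 * ((1 : NNReal) : ℝ))) (-z) z := by
      have := ((((hasDerivAt_id z).sub_const 0).pow 2).neg).div_const (2 * ((1 : NNReal) : ℝ))
      refine this.congr_deriv ?_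
      simp
      ring
    have := h1.exp.const_mul (√(2 * Real.pi * ((1 : NNReal) : ℝ)))⁻¹
    exact this.congr_deriv (by ring)
  have hderh : ∀ z, HasDerivAt (fun z => h (x + σ * z)) (σ * h' (x + σ * z)) z := by
    intro z
    have h1 : HasDerivAt (fun s : ℝ => x + σ * s) σ z := by
      simpa using ((hasDerivAt_id z).const_mul σ).const_add x
    rw [mul_comm]
    exact (hd _).comp z h1
  have i1 := hpdf (hh.integrable_mul_comp x σ)
  have i2 := hpdf ((hh'.integrable_comp x σ).const_mul σ)
  have key := integral_eq_zero_of_hasDerivAt_of_integrable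
    (f := fun z => gaussianPDFReal 0 1 z * h (x + σ * z))
    (f' := fun z => gaussianPDFReal 0 1 z * (σ * h' (x + σ * z)) -
      gaussianPDFReal 0 1 z * (z * h (x + σ * z)))
    (fun z => ((hder z).mul (hderh z)).congr_deriv (by ring))
    (i2.sub i1) (hpdf (hh.integrable_comp x σ))
  rw [integral_sub i2 i1, sub_eq_zero] at key
  rw [gaussAvg, ← MeasureTheory.integral_const_mul, integral_gaussianReal_eq_integral_smul one_ne_zero,
    integral_gaussianReal_eq_integral_smul one_ne_zero]
  simpa only [smul_eq_mul] using key.symm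

/-- The heat equation for the Gaussian semigroup. -/
lemma hasDerivAt_gaussAvg_sqrt (hh : HasExpGrowth h K) (hh' : HasExpGrowth h' K')
    (hh'' : HasExpGrowth h'' K'') (hd : ∀ y, HasDerivAt h (h' y) y)
    (hd' : ∀ y, HasDerivAt h' (h'' y) y) (x : ℝ) {s : ℝ} (hs : 0 < s) :
    HasDerivAt (fun s => gaussAvg h x √s) (gaussAvg h'' x √s / 2) s := by
  have h1 := hh.hasDerivAt_gaussAvg_scale hh' hd x √s
  rw [hh'.integral_mul_comp_eq hh'' hd'] at h1
  refine (h1.comp s (Real.hasDerivAt_sqrt hs.ne')).congr_deriv ?_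
  have := (Real.sqrt_pos.2 hs).ne'
  field_simp

lemma primitive (hh : HasExpGrowth h K) : HasExpGrowth (fun y => ∫ r in (0:ℝ)..y, h r) K := by
  refine ⟨continuous_primitive (fun a b => hh.1.intervalIntegrable a b) 0, fun y => ?_⟩
  have hK := hh.nonneg
  have hmain : ∀ (g : ℝ → ℝ), (∀ r, |g r| ≤ K * Real.exp |r|) → ∀ y, 0 ≤ y →
      |∫ r in (0:ℝ)..y, g r| ≤ K * Real.exp |y| := by
    intro g hb y hy
    have h1 : ‖∫ r in (0:ℝ)..y, g r‖ ≤ ∫ r in (0:ℝ)..y, K * Real.exp r := by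
      refine norm_integral_le_of_norm_le hy (ae_of_all _ fun r hr => ?_)
        (Continuous.intervalIntegrable (by fun_prop) _ _)
      simpa [abs_of_pos hr.1] using hb r
    refine h1.trans ?_
    rw [intervalIntegral.integral_const_mul, integral_exp, abs_of_nonneg hy, Real.exp_zero]
    gcongr
    linarith
  rcases le_total 0 y with hy | hy
  · exact hmain h hh.2 y hy
  · have := hmain (fun r => h (-r))
      (fun r => by simpa using hh.2 (-r)) (-y) (by linarith)
    rw [intervalIntegral.integral_comp_neg, abs_neg] at this
    beta_reduce
    rw [intervalIntegral.integral_symm, abs_neg]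
    simpa using this

lemma hasDerivAt_primitive (hh : HasExpGrowth h K) (y : ℝ) :
    HasDerivAt (fun y => ∫ r in (0:ℝ)..y, h r) (h y) y :=
  hh.1.integral_hasStrictDerivAt 0 y |>.hasDerivAt

lemma continuous_exp_mul_sub (hh : HasExpGrowth h K) (lam : ℝ) :
    Continuous (fun p : ℝ × ℝ =>
      Real.exp (-lam * p.2) * (gaussAvg h p.1 √p.2 - h p.1)) := by
  have h1 := hh.1
  have h2 : Continuous (fun p : ℝ × ℝ => gaussAvg h p.1 √p.2) :=
    hh.continuous_gaussAvg.comp (by fun_prop : Continuous fun p : ℝ × ℝ => (p.1, √p.2))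
  fun_prop

lemma continuous_gaussAvg_sqrt (hh : HasExpGrowth h K) (x : ℝ) :
    Continuous (fun s : ℝ => gaussAvg h x √s) :=
  hh.continuous_gaussAvg.comp (by fun_prop : Continuous fun s : ℝ => (x, √s))

end HasExpGrowth

/-- Twice the Duhamel integral of `h''`, after integrating by parts in time with the heat
equation. -/
noncomputable def heatPotential (lam t : ℝ) (h : ℝ → ℝ) (x : ℝ) : ℝ :=
  2 * (Real.exp (-lam * t) * (gaussAvg h x √t - h x) +
    lam * ∫ s in (0:ℝ)..t, Real.exp (-lam * s) * (gaussAvg h x √s - h x))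

lemma gaussAvg_zero_right (h : ℝ → ℝ) (x : ℝ) : gaussAvg h x 0 = h x := by
  simp [gaussAvg]

namespace HasExpGrowth

variable {h h' h'' : ℝ → ℝ} {K K' K'' : ℝ}

lemma integral_eq_heatPotential (hh : HasExpGrowth h K) (hh' : HasExpGrowth h' K')
    (hh'' : HasExpGrowth h'' K'') (hd : ∀ y, HasDerivAt h (h' y) y)
    (hd' : ∀ y, HasDerivAt h' (h'' y) y) (lam x : ℝ) {t : ℝ} (ht : 0 ≤ t) :
    ∫ s in (0:ℝ)..t, Real.exp (-lam * s) * gaussAvg h'' x √s = heatPotential lam t h x := by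
  have c0 := hh.continuous_gaussAvg_sqrt x
  have c2 := hh''.continuous_gaussAvg_sqrt x
  have hexp : ∀ s : ℝ, HasDerivAt (fun s => Real.exp (-lam * s)) (Real.exp (-lam * s) * -lam) s :=
    fun s => by simpa using ((hasDerivAt_id s).const_mul (-lam)).exp
  have key := intervalIntegral.integral_eq_sub_of_hasDerivAt_of_le
    (f := fun s => Real.exp (-lam * s) * (gaussAvg h x √s - h x))
    (f' := fun s => 2⁻¹ * (Real.exp (-lam * s) * gaussAvg h'' x √s) -
      lam * (Real.exp (-lam * s) * (gaussAvg h x √s - h x))) ht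
    (by fun_prop)
    (fun s hs => ((hexp s).mul
      ((hh.hasDerivAt_gaussAvg_sqrt hh' hh'' hd hd' x hs.1).sub_const (h x))).congr_deriv (by ring))
    (Continuous.intervalIntegrable (by fun_prop) _ _)
  rw [intervalIntegral.integral_sub (Continuous.intervalIntegrable (by fun_prop) _ _)
    (Continuous.intervalIntegrable (by fun_prop) _ _), intervalIntegral.integral_const_mul,
    intervalIntegral.integral_const_mul] at key
  simp only [Real.sqrt_zero, gaussAvg_zero_right, sub_self, mul_zero, sub_zero] at key
  rw [heatPotential]
  linarith

lemma hasDerivAt_heatPotential (hh : HasExpGrowth h K) (hh' : HasExpGrowth h' K')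
    (hd : ∀ y, HasDerivAt h (h' y) y) (lam t x : ℝ) :
    HasDerivAt (heatPotential lam t h) (heatPotential lam t h' x) x := by
  have hD : ∀ s y : ℝ, HasDerivAt
      (fun y => Real.exp (-lam * s) * (gaussAvg h y √s - h y))
      (Real.exp (-lam * s) * (gaussAvg h' y √s - h' y)) y := fun s y =>
    ((hh.hasDerivAt_gaussAvg_space hh' hd y √s).sub (hd y)).const_mul _
  have hc := hh.continuous_exp_mul_sub lam
  have hc' := hh'.continuous_exp_mul_sub lam
  obtain ⟨C, hC⟩ := ((isCompact_closedBall x 1).prod (isCompact_uIcc (a := 0) (b := t)))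
    |>.exists_bound_of_continuousOn hc'.continuousOn
  have hI := (intervalIntegral.hasDerivAt_integral_of_dominated_loc_of_deriv_le
    (μ := volume) (a := 0) (b := t) (x₀ := x) (bound := fun _ => C)
    (F := fun y s => Real.exp (-lam * s) * (gaussAvg h y √s - h y))
    (F' := fun y s => Real.exp (-lam * s) * (gaussAvg h' y √s - h' y))
    (Metric.closedBall_mem_nhds x one_pos)
    (Eventually.of_forall fun y =>
      (hc.comp (Continuous.prodMk_right y)).aestronglyMeasurable)
    ((hc.comp (Continuous.prodMk_right x)).intervalIntegrable _ _)
    (hc'.comp (Continuous.prodMk_right x)).aestronglyMeasurable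
    (ae_of_all _ fun s hs y hy => hC (y, s) ⟨hy, uIoc_subset_uIcc hs⟩)
    intervalIntegrable_const
    (ae_of_all _ fun s _ y _ => hD s y)).2
  exact ((hD t x).add (hI.const_mul lam)).const_mul 2

end HasExpGrowth

lemma abs_exp_mul_le {lam s a c : ℝ} (hlam : 0 ≤ lam) (hs : 0 ≤ s) (h : |a| ≤ c) :
    |Real.exp (-lam * s) * a| ≤ c := by
  rw [abs_mul, Real.abs_exp]
  have h1 : Real.exp (-lam * s) ≤ 1 := Real.exp_le_one_iff.2 (by nlinarith)
  calc _ ≤ 1 * c := by gcongr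
    _ = c := one_mul c

lemma abs_integral_le_mul {g : ℝ → ℝ} {t T c : ℝ} (ht : t ∈ Icc 0 T)
    (h : ∀ s ∈ Icc 0 T, |g s| ≤ c) : |∫ s in (0:ℝ)..t, g s| ≤ c * T := by
  have hc : 0 ≤ c := (abs_nonneg _).trans (h t ht)
  rw [← Real.norm_eq_abs]
  refine (intervalIntegral.norm_integral_le_of_norm_le_const (C := c) fun s hs => ?_).trans ?_
  · rw [uIoc_of_le ht.1] at hs
    exact h s ⟨hs.1.le, hs.2.trans ht.2⟩
  · rw [sub_zero, abs_of_nonneg ht.1]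
    gcongr
    exact ht.2

lemma abs_heatPotential_le {h : ℝ → ℝ} {lam t T c x : ℝ} (hlam : 0 ≤ lam) (ht : t ∈ Icc 0 T)
    (hb : ∀ s ∈ Icc 0 T, |gaussAvg h x √s - h x| ≤ c) :
    |heatPotential lam t h x| ≤ 2 * (c + lam * (c * T)) := by
  rw [heatPotential, abs_mul, abs_two]
  gcongr
  refine (abs_add_le _ _).trans ?_
  gcongr
  · exact abs_exp_mul_le hlam ht.1 (hb t ht)
  · rw [abs_mul, abs_of_nonneg hlam]
    gcongr
    exact abs_integral_le_mul ht fun s hs => abs_exp_mul_le hlam hs.1 (hb s hs)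

lemma HasExpGrowth.abs_heatPotential_sub_le {h : ℝ → ℝ} {K lam t T c x y : ℝ}
    (hh : HasExpGrowth h K) (hlam : 0 ≤ lam) (ht : t ∈ Icc 0 T)
    (hb : ∀ s ∈ Icc 0 T, |(gaussAvg h x √s - h x) - (gaussAvg h y √s - h y)| ≤ c) :
    |heatPotential lam t h x - heatPotential lam t h y| ≤ 2 * (c + lam * (c * T)) := by
  have hint : ∀ x, IntervalIntegrable
      (fun s => Real.exp (-lam * s) * (gaussAvg h x √s - h x)) volume 0 t := fun x =>
    ((hh.continuous_exp_mul_sub lam).comp (Continuous.prodMk_right x)).intervalIntegrable _ _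
  have heq : heatPotential lam t h x - heatPotential lam t h y =
      2 * (Real.exp (-lam * t) * ((gaussAvg h x √t - h x) - (gaussAvg h y √t - h y)) +
        lam * ∫ s in (0:ℝ)..t,
          Real.exp (-lam * s) * ((gaussAvg h x √s - h x) - (gaussAvg h y √s - h y))) := by
    simp_rw [mul_sub (Real.exp _) (gaussAvg h x _ - h x)]
    rw [intervalIntegral.integral_sub (hint x) (hint y), heatPotential, heatPotential]
    ring
  rw [heq, abs_mul, abs_two]
  gcongr
  refine (abs_add_le _ _).trans ?_
  gcongr
  · exact abs_exp_mul_le hlam ht.1 (hb t ht)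
  · rw [abs_mul, abs_of_nonneg hlam]
    gcongr
    exact abs_integral_le_mul ht fun s hs => abs_exp_mul_le hlam hs.1 (hb s hs)

/-- The heat kernel integral is a Gaussian average. -/
lemma integral_heatKernel_eq_gaussAvg {f : ℝ → ℝ} (hf : Continuous f) (x : ℝ) {s : ℝ}
    (hs : 0 < s) :
    ∫ y : ℝ, (2 * Real.pi * s) ^ (-(1:ℝ) / 2) * Real.exp (-(x - y) ^ 2 / (2 * s)) * f y =
      gaussAvg f x √s := by
  have hmap : (gaussianReal 0 1).map (fun z => x + √s * z) = gaussianReal x (.mk s hs.le) := by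
    have : (fun z => x + √s * z) = (x + ·) ∘ (√s * ·) := rfl
    rw [this, ← Measure.map_map (by fun_prop) (by fun_prop), gaussianReal_map_const_mul,
      gaussianReal_map_const_add]
    congr 1
    · simp
    · ext
      simp [Real.sq_sqrt hs.le]
  have hv : NNReal.mk s hs.le ≠ 0 := fun h => hs.ne' (congrArg NNReal.toReal h)
  rw [gaussAvg, ← integral_map (f := f) (by fun_prop) hf.aestronglyMeasurable, hmap,
    integral_gaussianReal_eq_integral_smul hv]
  refine integral_congr_ae (ae_of_all _ fun y => ?_)
  have hpos : 0 ≤ 2 * Real.pi * s := by positivity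
  simp only [gaussianPDFReal, smul_eq_mul, NNReal.coe_mk]
  rw [Real.sqrt_eq_rpow, ← Real.rpow_neg hpos, ← neg_sub y x, neg_sq]
  norm_num

lemma heat_integral_eq {f : ℝ → ℝ} (hf : Continuous f) (lam x : ℝ) {t : ℝ} (ht : 0 ≤ t) :
    (∫ r in (0:ℝ)..t, Real.exp (-lam * (t - r)) *
        ∫ y : ℝ, (2 * Real.pi * (t - r)) ^ (-(1:ℝ) / 2) *
          Real.exp (-(x - y) ^ 2 / (2 * (t - r))) * f y) =
      ∫ s in (0:ℝ)..t, Real.exp (-lam * s) * gaussAvg f x √s := by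
  rw [intervalIntegral.integral_comp_sub_left (fun s => Real.exp (-lam * s) *
    ∫ y : ℝ, (2 * Real.pi * s) ^ (-(1:ℝ) / 2) * Real.exp (-(x - y) ^ 2 / (2 * s)) * f y) t]
  rw [sub_self, sub_zero]
  refine intervalIntegral.integral_congr_ae (ae_of_all _ fun s hs => ?_)
  rw [uIoc_of_le ht] at hs
  rw [integral_heatKernel_eq_gaussAvg hf x hs.1]

lemma heat_integral_of_nonpos (f : ℝ → ℝ) (lam x : ℝ) {t : ℝ} (ht : t ≤ 0) :
    (∫ r in (0:ℝ)..t, Real.exp (-lam * (t - r)) *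
        ∫ y : ℝ, (2 * Real.pi * (t - r)) ^ (-(1:ℝ) / 2) *
          Real.exp (-(x - y) ^ 2 / (2 * (t - r))) * f y) = 0 := by
  refine intervalIntegral.integral_zero_ae (ae_of_all _ fun r hr => ?_)
  rw [uIoc_of_ge ht] at hr
  have hz : (2 * Real.pi * (t - r)) ^ (-(1:ℝ) / 2) = 0 := by
    rcases hr.1.le.lt_or_eq with h | h
    · have hneg : 2 * Real.pi * (t - r) < 0 :=
        mul_neg_of_pos_of_neg (by positivity) (by linarith)
      rw [Real.rpow_def_of_neg hneg, neg_div, neg_mul, Real.cos_neg,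
        (by ring : 1 / 2 * Real.pi = Real.pi / 2), Real.cos_pi_div_two, mul_zero]
    · rw [h, sub_self, mul_zero, Real.zero_rpow (by norm_num)]
  simp [hz]

lemma abs_gaussAvg_sub_le {f : ℝ → ℝ} {K x x' σ ρ : ℝ} (hf : HasExpGrowth f K)
    (h : ∀ w, |f (x + w) - f (x' + w)| ≤ ρ) : |gaussAvg f x σ - gaussAvg f x' σ| ≤ ρ := by
  rw [gaussAvg, gaussAvg, ← integral_sub (hf.integrable_comp x σ) (hf.integrable_comp x' σ)]
  rw [← Real.norm_eq_abs]
  have := MeasureTheory.norm_integral_le_of_norm_le_const (μ := gaussianReal 0 1) (C := ρ)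
    (f := fun z => f (x + σ * z) - f (x' + σ * z)) (ae_of_all _ fun z => h (σ * z))
  simpa using this

lemma integrable_abs_gaussian : Integrable (fun z : ℝ => |z|) (gaussianReal 0 1) := by
  simpa using integrable_abs_mul_exp_gaussian 0

lemma integrable_sq_gaussian : Integrable (fun z : ℝ => z ^ 2) (gaussianReal 0 1) :=
  (memLp_id_gaussianReal' 2 (by simp)).integrable_sq

/-- Averaging a function with at most linear oscillation moves it by a bounded amount. -/
lemma abs_gaussAvg_sub_self_le {f : ℝ → ℝ} {K L : ℝ} (hf : HasExpGrowth f K)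
    (hosc : ∀ x y, |f x - f y| ≤ L * (1 + |x - y|)) (x σ : ℝ) :
    |gaussAvg f x σ - f x| ≤ L * (1 + |σ| * ∫ z, |z| ∂(gaussianReal 0 1)) := by
  have h1 : gaussAvg f x σ - f x = ∫ z, (f (x + σ * z) - f x) ∂(gaussianReal 0 1) := by
    rw [integral_sub (hf.integrable_comp x σ) (integrable_const _)]
    simp [gaussAvg]
  have h2 : L * (1 + |σ| * ∫ z, |z| ∂(gaussianReal 0 1)) =
      ∫ z, L * (1 + |σ| * |z|) ∂(gaussianReal 0 1) := by
    rw [MeasureTheory.integral_const_mul, integral_add (integrable_const _)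
      (integrable_abs_gaussian.const_mul _), MeasureTheory.integral_const_mul]
    simp
  have i1 : Integrable (fun z => 1 + |σ| * |z|) (gaussianReal 0 1) :=
    (integrable_const _).add (integrable_abs_gaussian.const_mul |σ|)
  rw [h1, h2, ← Real.norm_eq_abs]
  refine MeasureTheory.norm_integral_le_of_norm_le (i1.const_mul L)
    (ae_of_all _ fun z => ?_)
  simpa [abs_mul] using hosc (x + σ * z) x

/-- Averaging a function whose derivative has at most linear oscillation moves it by a bounded
amount, as the first-order term averages to zero. -/
lemma abs_gaussAvg_sub_self_le_of_hasDerivAt {g f : ℝ → ℝ} {K L : ℝ} (hg : HasExpGrowth g K)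
    (hf : Continuous f) (hd : ∀ y, HasDerivAt g (f y) y) (hL : 0 ≤ L)
    (hosc : ∀ x y, |f x - f y| ≤ L * (1 + |x - y|)) (x σ : ℝ) :
    |gaussAvg g x σ - g x| ≤
      L * (|σ| * (∫ z, |z| ∂(gaussianReal 0 1)) + σ ^ 2 * ∫ z, z ^ 2 ∂(gaussianReal 0 1)) := by
  have hid : Integrable (fun z : ℝ => z) (gaussianReal 0 1) :=
    integrable_abs_gaussian.mono (by fun_prop) (ae_of_all _ fun z => by simp)
  have htaylor : ∀ w, |g (x + w) - g x - w * f x| ≤ L * (|w| + w ^ 2) := by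
    intro w
    have hint : ∫ y in x..(x + w), (f y - f x) = g (x + w) - g x - w * f x := by
      rw [intervalIntegral.integral_sub (hf.intervalIntegrable _ _) intervalIntegrable_const,
        integral_eq_sub_of_hasDerivAt (fun y _ => hd y) (hf.intervalIntegrable _ _)]
      simp
    rw [← hint]
    rw [← Real.norm_eq_abs]
    refine (intervalIntegral.norm_integral_le_of_norm_le_const (C := L * (1 + |w|))
      fun y hy => ?_).trans ?_
    · refine (hosc y x).trans ?_
      have hyw : |y - x| ≤ |w| := by simpa using abs_sub_left_of_mem_uIcc (uIoc_subset_uIcc hy)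
      gcongr
    · rw [add_sub_cancel_left, ← sq_abs w]
      linarith
  have i1 : Integrable (fun z => g (x + σ * z) - g x) (gaussianReal 0 1) :=
    (hg.integrable_comp x σ).sub (integrable_const _)
  have i2 := (hid.const_mul σ).mul_const (f x)
  have h1 : gaussAvg g x σ - g x =
      ∫ z, (g (x + σ * z) - g x - σ * z * f x) ∂(gaussianReal 0 1) := by
    rw [integral_sub i1 i2, integral_sub (hg.integrable_comp x σ) (integrable_const _),
      MeasureTheory.integral_mul_const, MeasureTheory.integral_const_mul,
      integral_id_gaussianReal]
    simp [gaussAvg]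
  have j1 := integrable_abs_gaussian.const_mul |σ|
  have j2 := integrable_sq_gaussian.const_mul (σ ^ 2)
  rw [h1, ← MeasureTheory.integral_const_mul, ← MeasureTheory.integral_const_mul,
    ← integral_add j1 j2, ← MeasureTheory.integral_const_mul, ← Real.norm_eq_abs]
  have j3 : Integrable (fun z => |σ| * |z| + σ ^ 2 * z ^ 2) (gaussianReal 0 1) := j1.add j2
  refine MeasureTheory.norm_integral_le_of_norm_le (j3.const_mul L) (ae_of_all _ fun z => ?_)
  simpa [abs_mul, mul_pow] using htaylor (σ * z)

/-- A bound on increments at a fixed scale yields at most linear oscillation. -/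
lemma abs_sub_le_of_local {f : ℝ → ℝ} {M : ℝ} (hM : 0 ≤ M)
    (hloc : ∀ x y, |x - y| ≤ 1 / 4 → |f x - f y| ≤ M) (x y : ℝ) :
    |f x - f y| ≤ 4 * M * (1 + |x - y|) := by
  have hchain : ∀ (n : ℕ) (x y : ℝ), |x - y| ≤ (n + 1) / 4 → |f x - f y| ≤ M * (n + 1) := by
    intro n
    induction n with
    | zero => intro x y h; simpa using hloc x y (by simpa using h)
    | succ n ih =>
      intro x y h
      push_cast at h ⊢
      have hn : (0:ℝ) ≤ n := n.cast_nonneg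
      have e1 : x - (x + (y - x) / (n + 2)) = (x - y) / (n + 2) := by ring
      have e2 : x + (y - x) / (n + 2) - y = (x - y) * (n + 1) / (n + 2) := by field_simp; ring
      have h1 := hloc x (x + (y - x) / (n + 2)) (by
        rw [e1, abs_div, abs_of_pos (by positivity : (0:ℝ) < n + 2), div_le_iff₀ (by positivity)]
        linarith)
      have h2 := ih (x + (y - x) / (n + 2)) y (by
        rw [e2, abs_div, abs_mul, abs_of_pos (by positivity : (0:ℝ) < n + 2),
          abs_of_pos (by positivity : (0:ℝ) < n + 1), div_le_iff₀ (by positivity)]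
        nlinarith)
      have := abs_sub_le (f x) (f (x + (y - x) / (n + 2))) (f y)
      linarith
  have hfl := Nat.floor_le (by positivity : 0 ≤ 4 * |x - y|)
  refine (hchain ⌊4 * |x - y|⌋₊ x y ?_).trans ?_
  · have := Nat.lt_floor_add_one (4 * |x - y|)
    linarith
  · rw [mul_comm 4 M, mul_assoc]
    gcongr
    linarith

lemma abs_log_rpow_le_one {r β : ℝ} (hβ : β ≤ 0) (hr : 0 < r) (hr' : r ≤ 1 / 4) :
    |Real.log r| ^ β ≤ 1 := by
  refine Real.rpow_le_one_of_one_le_of_nonpos ?_ hβ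
  have h1 := Real.log_le_log hr hr'
  have h2 : Real.log (1 / 4) = -(2 * Real.log 2) := by
    rw [one_div, Real.log_inv, (by norm_num : (4:ℝ) = 2 ^ 2), Real.log_pow]
    norm_num
  have := Real.log_two_gt_d9
  exact le_abs.2 (Or.inr (by linarith))

/-- A function constant to the left of a point has derivative zero there. -/
lemma deriv_eq_zero_of_left_const {g : ℝ → ℝ} {a c : ℝ} (h : ∀ s ≤ a, g s = c) :
    deriv g a = 0 := by
  by_cases hg : DifferentiableAt ℝ g a
  · have h1 := hg.hasDerivAt.hasDerivWithinAt (s := Iic a)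
    have h2 : HasDerivWithinAt g 0 (Iic a) a :=
      (hasDerivWithinAt_const a (Iic a) c).congr (fun s hs => h s hs) (h a le_rfl)
    exact (uniqueDiffWithinAt_Iic a).eq_deriv _ h1 h2
  · exact deriv_zero_of_not_differentiableAt hg

/-- maximal Dini regularity for the 1-D heat equation,
Corollary 3.8. Let `β < -1`, `T > 0`, `λ ≥ 0`, and let `f : ℝ → ℝ` be
continuous, of at most linear growth, with
`|f(x) - f(y)| ≤ M |log|x-y||^β` for `0 < |x-y| < 1/2`. Then the solution
`u(t,x) = ∫_0^t e^{-λ(t-r)} ∫_ℝ (2π(t-r))^{-1/2} e^{-(x-y)²/(2(t-r))} f(y) dy dr`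
of `∂_t u = ½ ∂²_x u - λ u + f`, `u(0,·) = 0`, satisfies: `u/(1+|x|)`,
`∂_x u`, `∂²_x u`, `∂_t u/(1+|x|)` are bounded by a constant `C` uniformly on
`[0,T] × ℝ`, and both `∂²_x u(t,·)` and `∂_t u(t,·)` have modulus of
continuity `C |log|x-y||^β` for `0 < |x-y| < 1/2`. -/
theorem stmt5 (β T lam : ℝ) (hβ : β < -1) (hT : 0 < T) (hlam : 0 ≤ lam)
    (M : ℝ) (hM : 0 < M) (f : ℝ → ℝ) (hf_cont : Continuous f)
    (hf_growth : ∀ x : ℝ, |f x| ≤ M * (1 + |x|))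
    (hf_dini : ∀ x y : ℝ, 0 < |x - y| → |x - y| < 1 / 2 →
      |f x - f y| ≤ M * abs (Real.log |x - y|) ^ β)
    (u : ℝ → ℝ → ℝ)
    (hu : ∀ t x : ℝ, u t x =
      ∫ r in (0:ℝ)..t, Real.exp (-lam * (t - r)) *
        ∫ y : ℝ, (2 * Real.pi * (t - r)) ^ (-(1:ℝ) / 2) *
          Real.exp (-(x - y) ^ 2 / (2 * (t - r))) * f y) :
    ∃ C : ℝ, 0 < C ∧ ∀ t ∈ Set.Icc (0:ℝ) T,
      (∀ x : ℝ,
        |u t x| / (1 + |x|) ≤ C ∧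
        |deriv (u t) x| ≤ C ∧
        |deriv (deriv (u t)) x| ≤ C ∧
        |deriv (fun s => u s x) t| / (1 + |x|) ≤ C) ∧
      (∀ x y : ℝ, 0 < |x - y| → |x - y| < 1 / 2 →
        |deriv (deriv (u t)) x - deriv (deriv (u t)) y| ≤
          C * abs (Real.log |x - y|) ^ β) ∧
      (∀ x y : ℝ, 0 < |x - y| → |x - y| < 1 / 2 →
        |deriv (fun s => u s x) t - deriv (fun s => u s y) t| ≤
          C * abs (Real.log |x - y|) ^ β) := by
  have hfE : HasExpGrowth f M := ⟨hf_cont, fun y => (hf_growth y).trans (by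
    have := Real.add_one_le_exp |y|
    gcongr
    linarith)⟩
  have hgE := hfE.primitive
  have hg := hfE.hasDerivAt_primitive
  have hFE := hgE.primitive
  have hF := hgE.hasDerivAt_primitive
  set g : ℝ → ℝ := fun y => ∫ r in (0:ℝ)..y, f r
  set F : ℝ → ℝ := fun y => ∫ r in (0:ℝ)..y, g r
  have hosc : ∀ x y, |f x - f y| ≤ 4 * M * (1 + |x - y|) := by
    refine abs_sub_le_of_local hM.le fun x y h => ?_
    rcases (abs_nonneg (x - y)).eq_or_lt with h0 | h0
    · rw [sub_eq_zero.1 (abs_eq_zero.1 h0.symm), sub_self, abs_zero]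
      exact hM.le
    · refine (hf_dini x y h0 (by linarith)).trans (mul_le_of_le_one_right hM.le ?_)
      exact abs_log_rpow_le_one (by linarith) h0 h
  set m₁ := ∫ z, |z| ∂(gaussianReal 0 1)
  set m₂ := ∫ z, z ^ 2 ∂(gaussianReal 0 1)
  have hm₁ : 0 ≤ m₁ := integral_nonneg fun z => abs_nonneg z
  have hm₂ : 0 ≤ m₂ := integral_nonneg fun z => sq_nonneg z
  set a := 4 * M * (1 + √T * m₁)
  set b := 4 * M * (√T * m₁ + √T ^ 2 * m₂)
  have ha : 0 ≤ a := by positivity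
  have hb : 0 ≤ b := by positivity
  have hfb : ∀ x, ∀ s ∈ Icc 0 T, |gaussAvg f x √s - f x| ≤ a := fun x s hs =>
    (abs_gaussAvg_sub_self_le hfE hosc x √s).trans (by
      rw [abs_of_nonneg (Real.sqrt_nonneg s)]
      have := Real.sqrt_le_sqrt hs.2
      change _ ≤ 4 * M * (1 + √T * m₁)
      gcongr)
  have hgb : ∀ x, ∀ s ∈ Icc 0 T, |gaussAvg g x √s - g x| ≤ b := fun x s hs =>
    (abs_gaussAvg_sub_self_le_of_hasDerivAt hgE hf_cont hg (by positivity) hosc x √s).trans (by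
      rw [abs_of_nonneg (Real.sqrt_nonneg s)]
      have := Real.sqrt_le_sqrt hs.2
      change _ ≤ 4 * M * (√T * m₁ + √T ^ 2 * m₂)
      gcongr)
  have hgrow : ∀ x, ∀ s ∈ Icc 0 T, |gaussAvg f x √s| ≤ (a + M) * (1 + |x|) := fun x s hs => by
    have h1 := abs_add_le (gaussAvg f x √s - f x) (f x)
    rw [sub_add_cancel] at h1
    nlinarith [hfb x s hs, hf_growth x, mul_nonneg ha (abs_nonneg x)]
  have hmod : ∀ x y : ℝ, 0 < |x - y| → |x - y| < 1 / 2 → ∀ s,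
      |gaussAvg f x √s - gaussAvg f y √s| ≤ M * abs (Real.log |x - y|) ^ β := fun x y h0 h1 s =>
    abs_gaussAvg_sub_le hfE fun w => by
      have e : x + w - (y + w) = x - y := by ring
      simpa only [e] using hf_dini (x + w) (y + w) (by rwa [e]) (by rwa [e])
  have hu_eq : ∀ t x, 0 ≤ t → u t x = ∫ s in (0:ℝ)..t, Real.exp (-lam * s) * gaussAvg f x √s :=
    fun t x ht => (hu t x).trans (heat_integral_eq hf_cont lam x ht)
  have hu_pot : ∀ t, 0 ≤ t → u t = heatPotential lam t F := fun t ht => funext fun x =>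
    (hu_eq t x ht).trans (hFE.integral_eq_heatPotential hgE hfE hF hg lam x ht)
  have hd1 : ∀ t, 0 ≤ t → deriv (u t) = heatPotential lam t g := fun t ht => by
    rw [hu_pot t ht]
    exact funext fun x => (hFE.hasDerivAt_heatPotential hgE hF lam t x).deriv
  have hd2 : ∀ t, 0 ≤ t → deriv (deriv (u t)) = heatPotential lam t f := fun t ht => by
    rw [hd1 t ht]
    exact funext fun x => (hgE.hasDerivAt_heatPotential hfE hg lam t x).deriv
  have hdt0 : ∀ x, deriv (fun s => u s x) 0 = 0 := fun x =>
    deriv_eq_zero_of_left_const fun s hs => (hu s x).trans (heat_integral_of_nonpos f lam x hs)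
  have hdt : ∀ t x, 0 < t → deriv (fun s => u s x) t = Real.exp (-lam * t) * gaussAvg f x √t :=
    fun t x ht => by
      have hc : Continuous fun s => Real.exp (-lam * s) * gaussAvg f x √s := by
        have := hfE.continuous_gaussAvg_sqrt x
        fun_prop
      refine HasDerivAt.deriv
        ((hc.integral_hasStrictDerivAt 0 t).hasDerivAt.congr_of_eventuallyEq ?_)
      filter_upwards [lt_mem_nhds ht] with s hs using hu_eq s x hs.le
  have hdivle : ∀ {A C x : ℝ}, A ≤ C * (1 + |x|) → A / (1 + |x|) ≤ C := fun h =>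
    (div_le_iff₀ (by positivity)).2 h
  set C := (a + M) * (T + 1) + 2 * (a + lam * (a * T)) + 2 * (b + lam * (b * T)) +
    2 * (2 * M + lam * (2 * M * T))
  have p1 : 0 < (a + M) * (T + 1) := by positivity
  have p1' : 0 < (a + M) * T := by positivity
  have p2 : 0 ≤ 2 * (a + lam * (a * T)) := by positivity
  have p3 : 0 ≤ 2 * (b + lam * (b * T)) := by positivity
  have p4 : 0 ≤ 2 * (2 * M + lam * (2 * M * T)) := by positivity
  have hMC : M ≤ C := by
    have : 0 ≤ lam * (2 * M * T) := by positivity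
    linarith
  have haC : a + M ≤ C := by linarith
  have haTC : (a + M) * T ≤ C := by linarith
  have hCpos : 0 < C := by linarith
  refine ⟨C, hCpos, fun t ht => ⟨fun x => ⟨hdivle ?_, ?_, ?_, hdivle ?_⟩, fun x y h0 h1 => ?_,
    fun x y h0 h1 => ?_⟩⟩
  · rw [hu_eq t x ht.1]
    refine (abs_integral_le_mul ht fun s hs =>
      abs_exp_mul_le hlam hs.1 (hgrow x s hs)).trans ?_
    rw [mul_right_comm]
    gcongr
  · rw [hd1 t ht.1]
    linarith [abs_heatPotential_le hlam ht (hgb x)]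
  · rw [hd2 t ht.1]
    linarith [abs_heatPotential_le hlam ht (hfb x)]
  · rcases ht.1.eq_or_lt with rfl | htp
    · rw [hdt0, abs_zero]
      positivity
    · rw [hdt t x htp]
      refine (abs_exp_mul_le hlam ht.1 (hgrow x t ht)).trans ?_
      gcongr
  · rw [hd2 t ht.1]
    set ρ := abs (Real.log |x - y|) ^ β
    have hρ : 0 ≤ ρ := by positivity
    refine (hfE.abs_heatPotential_sub_le (c := 2 * M * ρ) hlam ht fun s _ => ?_).trans ?_
    · rw [sub_sub_sub_comm]
      refine (abs_sub _ _).trans ?_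
      linarith [hmod x y h0 h1 s, hf_dini x y h0 h1]
    · calc _ = 2 * (2 * M + lam * (2 * M * T)) * ρ := by ring
        _ ≤ C * ρ := by
          gcongr
          linarith
  · rcases ht.1.eq_or_lt with rfl | htp
    · rw [hdt0, hdt0, sub_self, abs_zero]
      positivity
    · rw [hdt t x htp, hdt t y htp, ← mul_sub]
      refine (abs_exp_mul_le hlam ht.1 (hmod x y h0 h1 t)).trans ?_
      gcongr
end

section
/- Let α ∈ [0,1) and let ρ : (0,1] → (0,∞) be increasing, continuous and slowly varying at zero, with ∫_0^1 ρ(r) r^{α−1} dr < ∞. Then there exists a constant C > 0 such that for every δ ∈ (0,1/3]: ∫_{2δ}^{3δ} ρ(r) r^{α−1} dr ≤ C ∫_0^δ ρ(r) r^{α−1} dr. -/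
open MeasureTheory Filter Set

/-- `ρ` is slowly varying at zero (in Karamata's sense): for every `υ > 0`,
`ρ(υ r)/ρ(r) → 1` as `r → 0⁺`. -/
def SlowlyVaryingAtZero (ρ : ℝ → ℝ) : Prop :=
  ∀ υ : ℝ, 0 < υ →
    Filter.Tendsto (fun r : ℝ => ρ (υ * r) / ρ r) (nhdsWithin 0 (Set.Ioi 0)) (nhds 1)

/-- A monotone positive slowly varying function satisfies a doubling-type bound on all of
`(0, 1]`, not only near zero. -/
theorem SlowlyVaryingAtZero.exists_le_mul {ρ : ℝ → ℝ} (hslow : SlowlyVaryingAtZero ρ)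
    (hpos : ∀ r ∈ Set.Ioc (0:ℝ) 1, 0 < ρ r) (hmono : MonotoneOn ρ (Set.Ioc 0 1))
    {υ : ℝ} (hυ : 1 ≤ υ) :
    ∃ K : ℝ, 0 < K ∧ ∀ r : ℝ, 0 < r → υ * r ≤ 1 → ρ (υ * r) ≤ K * ρ r := by
  have hev := (hslow υ (by linarith)).eventually_lt_const (show (1:ℝ) < 2 by norm_num)
  obtain ⟨ε, hε, hlt⟩ := mem_nhdsGT_iff_exists_Ioo_subset.mp hev
  have hε' : (0:ℝ) < ε := hε
  have hmem : min ε 1 ∈ Set.Ioc (0:ℝ) 1 := ⟨lt_min hε' one_pos, min_le_right _ _⟩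
  have hm := hpos _ hmem
  have h1 := hpos 1 ⟨one_pos, le_rfl⟩
  refine ⟨max 2 (ρ 1 / ρ (min ε 1)), by positivity, fun r hr hυr => ?_⟩
  have hr1 : r ∈ Set.Ioc (0:ℝ) 1 := ⟨hr, by nlinarith⟩
  have hρr := hpos r hr1
  rcases lt_or_ge r ε with h | h
  · have h2 : ρ (υ * r) / ρ r < 2 := hlt ⟨hr, h⟩
    calc ρ (υ * r) ≤ 2 * ρ r := ((div_lt_iff₀ hρr).mp h2).le
      _ ≤ _ := by gcongr; exact le_max_left _ _
  · calc ρ (υ * r) ≤ ρ 1 := hmono ⟨by positivity, hυr⟩ ⟨one_pos, le_rfl⟩ hυr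
      _ = ρ 1 / ρ (min ε 1) * ρ (min ε 1) := by field_simp
      _ ≤ max 2 (ρ 1 / ρ (min ε 1)) * ρ r := by
        gcongr
        · exact le_max_right _ _
        · exact hmono hmem hr1 ((min_le_left _ _).trans h)

/-- If `α ∈ [0,1)` and `ρ : (0,1] → (0,∞)` is increasing,
continuous and slowly varying at zero with `∫_0^1 ρ(r) r^{α-1} dr < ∞`, then
there is `C > 0` such that for all `δ ∈ (0,1/3]`,
`∫_{2δ}^{3δ} ρ(r) r^{α-1} dr ≤ C ∫_0^δ ρ(r) r^{α-1} dr`. -/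
theorem stmt15 (α : ℝ) (hα : α ∈ Set.Ico (0:ℝ) 1) (ρ : ℝ → ℝ)
    (hρpos : ∀ r ∈ Set.Ioc (0:ℝ) 1, 0 < ρ r)
    (hmono : MonotoneOn ρ (Set.Ioc 0 1))
    (hcont : ContinuousOn ρ (Set.Ioc 0 1))
    (hslow : SlowlyVaryingAtZero ρ)
    (hint : IntegrableOn (fun r : ℝ => ρ r * r ^ (α - 1)) (Set.Ioc 0 1) volume) :
    ∃ C : ℝ, 0 < C ∧ ∀ δ ∈ Set.Ioc (0:ℝ) (1 / 3),
      ∫ r in Set.Ioc (2 * δ) (3 * δ), ρ r * r ^ (α - 1) ≤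
        C * ∫ r in Set.Ioc (0:ℝ) δ, ρ r * r ^ (α - 1) := by
  obtain ⟨K, hK, hρK⟩ := hslow.exists_le_mul hρpos hmono (show (1:ℝ) ≤ 6 by norm_num)
  refine ⟨2 * K, by positivity, fun δ ⟨hδ, hδ3⟩ => ?_⟩
  have hα1 : α - 1 ≤ 0 := by linarith [hα.2]
  have hupper : ∫ r in Set.Ioc (2 * δ) (3 * δ), ρ r * r ^ (α - 1) ≤
      δ * (ρ (3 * δ) * δ ^ (α - 1)) := by
    calc ∫ r in Set.Ioc (2 * δ) (3 * δ), ρ r * r ^ (α - 1)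
        ≤ ∫ _ in Set.Ioc (2 * δ) (3 * δ), ρ (3 * δ) * δ ^ (α - 1) := by
          refine setIntegral_mono_on
            (hint.mono_set (Set.Ioc_subset_Ioc (by positivity) (by linarith)))
            (integrableOn_const measure_Ioc_lt_top.ne) measurableSet_Ioc fun r ⟨hr, hr'⟩ => ?_
          have hr0 : 0 < r := by linarith
          have h3 := hρpos (3 * δ) ⟨by positivity, by linarith⟩
          exact mul_le_mul (hmono ⟨hr0, by linarith⟩ ⟨by positivity, by linarith⟩ hr')
            (Real.rpow_le_rpow_of_nonpos hδ (by linarith) hα1) (by positivity) h3.le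
      _ = δ * (ρ (3 * δ) * δ ^ (α - 1)) := by
          rw [setIntegral_const, Real.volume_real_Ioc_of_le (by linarith), smul_eq_mul]
          ring
  have hlower : δ / 2 * (ρ (δ / 2) * δ ^ (α - 1)) ≤
      ∫ r in Set.Ioc (0:ℝ) δ, ρ r * r ^ (α - 1) := by
    have hintδ := hint.mono_set (Set.Ioc_subset_Ioc le_rfl (by linarith : δ ≤ 1))
    have hsub : Set.Ioc (δ / 2) δ ⊆ Set.Ioc 0 δ := Set.Ioc_subset_Ioc_left (by positivity)
    calc δ / 2 * (ρ (δ / 2) * δ ^ (α - 1))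
        = ∫ _ in Set.Ioc (δ / 2) δ, ρ (δ / 2) * δ ^ (α - 1) := by
          rw [setIntegral_const, Real.volume_real_Ioc_of_le (by linarith), smul_eq_mul]
          ring
      _ ≤ ∫ r in Set.Ioc (δ / 2) δ, ρ r * r ^ (α - 1) := by
          refine setIntegral_mono_on (integrableOn_const measure_Ioc_lt_top.ne)
            (hintδ.mono_set hsub) measurableSet_Ioc
            fun r ⟨hr, hr'⟩ => ?_
          have hr0 : 0 < r := by linarith
          have hρr := hρpos r ⟨hr0, by linarith⟩
          exact mul_le_mul (hmono ⟨by positivity, by linarith⟩ ⟨hr0, by linarith⟩ hr.le)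
            (Real.rpow_le_rpow_of_nonpos hr0 hr' hα1) (by positivity) hρr.le
      _ ≤ ∫ r in Set.Ioc (0:ℝ) δ, ρ r * r ^ (α - 1) := by
          refine setIntegral_mono_set hintδ ?_ hsub.eventuallyLE
          filter_upwards [ae_restrict_mem measurableSet_Ioc] with r ⟨hr, hr'⟩
          have hρr := hρpos r ⟨hr, by linarith⟩
          exact mul_nonneg hρr.le (by positivity)
  have hρ : ρ (3 * δ) ≤ K * ρ (δ / 2) := by
    have h := hρK (δ / 2) (by positivity) (by linarith)
    rwa [show 6 * (δ / 2) = 3 * δ by ring] at h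
  calc ∫ r in Set.Ioc (2 * δ) (3 * δ), ρ r * r ^ (α - 1)
      ≤ δ * (ρ (3 * δ) * δ ^ (α - 1)) := hupper
    _ ≤ δ * (K * ρ (δ / 2) * δ ^ (α - 1)) := by gcongr
    _ = 2 * K * (δ / 2 * (ρ (δ / 2) * δ ^ (α - 1))) := by ring
    _ ≤ 2 * K * ∫ r in Set.Ioc (0:ℝ) δ, ρ r * r ^ (α - 1) := by gcongr
end

section
/- Let ρ : (0,1] → (0,∞) be increasing, continuous, slowly varying at zero, with ρ(r) → 0 as r → 0⁺, and let θ ∈ (0,1]. Then sup{ e^{−τ²/(8r)} · ( ρ(τ)/ρ(√r) )^θ : τ ∈ (0,1], r ∈ (0,1] } < ∞. -/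
open Filter Set

/-- A positive monotone function on `(0,1]` that is slowly varying at zero is doubling. -/
theorem SlowlyVaryingAtZero.exists_doubling {ρ : ℝ → ℝ} (hslow : SlowlyVaryingAtZero ρ)
    (hρpos : ∀ r ∈ Set.Ioc (0:ℝ) 1, 0 < ρ r) (hmono : MonotoneOn ρ (Set.Ioc 0 1)) :
    ∃ p : ℕ, ∀ t ∈ Set.Ioc (0:ℝ) 1, ρ t ≤ 2 ^ p * ρ (t / 2) := by
  have hev : ∀ᶠ r in nhdsWithin (0:ℝ) (Set.Ioi 0), ρ (2 * r) / ρ r < 2 :=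
    (hslow 2 two_pos).eventually_lt_const one_lt_two
  obtain ⟨u, hu, hsub⟩ := mem_nhdsGT_iff_exists_Ioo_subset.1 hev
  have hu0 : 0 < u := hu
  set δ := min u 1 with hδ
  have hδ0 : 0 < δ := lt_min hu0 one_pos
  have hδmem : δ ∈ Set.Ioc (0:ℝ) 1 := ⟨hδ0, min_le_right _ _⟩
  obtain ⟨n, hn⟩ := pow_unbounded_of_one_lt (ρ 1 / ρ δ) (one_lt_two (α := ℝ))
  refine ⟨n + 1, fun t ht => ?_⟩
  have ht2 : t / 2 ∈ Set.Ioc (0:ℝ) 1 := ⟨half_pos ht.1, by linarith [ht.2]⟩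
  have hpos := hρpos _ ht2
  have hone : (1:ℝ) ≤ 2 ^ n := one_le_pow₀ one_le_two
  rw [pow_succ]
  rcases lt_or_ge (t / 2) δ with hlt | hge
  · have h : ρ (2 * (t / 2)) / ρ (t / 2) < 2 :=
      hsub ⟨ht2.1, hlt.trans_le (min_le_left _ _)⟩
    rw [mul_div_cancel₀ t two_ne_zero, div_lt_iff₀ hpos] at h
    nlinarith
  · have h1 : ρ t ≤ ρ 1 := hmono ht ⟨one_pos, le_rfl⟩ ht.2
    have h2 : ρ δ ≤ ρ (t / 2) := hmono hδmem ht2 hge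
    rw [div_lt_iff₀ (hρpos _ hδmem)] at hn
    nlinarith

/-- A doubling monotone function on `(0,1]` has at most polynomial growth of its ratios. -/
theorem le_max_pow_mul_of_doubling {ρ : ℝ → ℝ} {p : ℕ}
    (hρpos : ∀ r ∈ Set.Ioc (0:ℝ) 1, 0 < ρ r) (hmono : MonotoneOn ρ (Set.Ioc 0 1))
    (hp : ∀ t ∈ Set.Ioc (0:ℝ) 1, ρ t ≤ 2 ^ p * ρ (t / 2))
    {s t : ℝ} (hs : s ∈ Set.Ioc (0:ℝ) 1) (ht : t ∈ Set.Ioc (0:ℝ) 1) :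
    ρ t ≤ max 1 (2 * (t / s)) ^ p * ρ s := by
  have base : ∀ t ∈ Set.Ioc (0:ℝ) 1, t ≤ s → ρ t ≤ max 1 (2 * (t / s)) ^ p * ρ s :=
    fun t ht hts => (hmono ht hs hts).trans
      (le_mul_of_one_le_left (hρpos s hs).le (one_le_pow₀ (le_max_left _ _)))
  have key : ∀ n : ℕ, ∀ t ∈ Set.Ioc (0:ℝ) 1, t ≤ 2 ^ n * s →
      ρ t ≤ max 1 (2 * (t / s)) ^ p * ρ s := by
    intro n
    induction n with
    | zero => exact fun t ht hts => base t ht (by simpa using hts)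
    | succ n ih =>
      intro t ht hts
      rcases le_or_gt t s with h | h
      · exact base t ht h
      have hx : 1 < t / s := (one_lt_div hs.1).2 h
      have ih' := ih (t / 2) ⟨half_pos ht.1, by linarith [ht.2]⟩ (by rw [pow_succ] at hts; linarith)
      have e : 2 * (t / 2 / s) = t / s := by ring
      rw [e, max_eq_right hx.le] at ih'
      rw [max_eq_right (by linarith), mul_pow, mul_assoc]
      exact (hp t ht).trans (by gcongr)
  obtain ⟨n, hn⟩ := pow_unbounded_of_one_lt (t / s) (one_lt_two (α := ℝ))
  exact key n t ht ((div_lt_iff₀ hs.1).1 hn).le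

/-- The Gaussian factor absorbs a polynomial one. -/
theorem exp_neg_sq_mul_max_pow_le (p : ℕ) (x : ℝ) :
    Real.exp (-(x ^ 2 / 8)) * max 1 (2 * x) ^ p ≤ 8 ^ p * p.factorial * Real.exp 1 := by
  have h1 : max 1 (2 * x) ≤ 8 * (1 + x ^ 2 / 8) :=
    max_le (by nlinarith [sq_nonneg x]) (by nlinarith [sq_nonneg (x - 1)])
  have h2 : max 1 (2 * x) ^ p ≤ 8 ^ p * (1 + x ^ 2 / 8) ^ p := by
    rw [← mul_pow]
    exact pow_le_pow_left₀ (zero_le_one.trans (le_max_left _ _)) h1 p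
  have h3 := Real.pow_div_factorial_le_exp (1 + x ^ 2 / 8) (by positivity) p
  rw [div_le_iff₀ (by positivity)] at h3
  calc Real.exp (-(x ^ 2 / 8)) * max 1 (2 * x) ^ p
      ≤ Real.exp (-(x ^ 2 / 8)) * (8 ^ p * (Real.exp (1 + x ^ 2 / 8) * p.factorial)) := by
        gcongr
        exact h2.trans (by gcongr)
    _ = 8 ^ p * p.factorial * (Real.exp (-(x ^ 2 / 8)) * Real.exp (1 + x ^ 2 / 8)) := by ring
    _ = 8 ^ p * p.factorial * Real.exp 1 := by
        rw [← Real.exp_add]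
        congr 2
        ring

/-- If `ρ : (0,1] → (0,∞)` is increasing, continuous, slowly
varying at zero with `ρ(r) → 0` as `r → 0⁺`, and `θ ∈ (0,1]`, then
`sup { e^{-τ²/(8r)} (ρ(τ)/ρ(√r))^θ : τ, r ∈ (0,1] } < ∞`. -/
theorem stmt19 (ρ : ℝ → ℝ)
    (hρpos : ∀ r ∈ Set.Ioc (0:ℝ) 1, 0 < ρ r)
    (hmono : MonotoneOn ρ (Set.Ioc 0 1))
    (hcont : ContinuousOn ρ (Set.Ioc 0 1))
    (hslow : SlowlyVaryingAtZero ρ)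
    (hzero : Filter.Tendsto ρ (nhdsWithin 0 (Set.Ioi 0)) (nhds 0))
    (θ : ℝ) (hθ : θ ∈ Set.Ioc (0:ℝ) 1) :
    ∃ M : ℝ, ∀ τ ∈ Set.Ioc (0:ℝ) 1, ∀ r ∈ Set.Ioc (0:ℝ) 1,
      Real.exp (-(τ ^ 2 / (8 * r))) * (ρ τ / ρ (Real.sqrt r)) ^ θ ≤ M := by
  obtain ⟨p, hp⟩ := hslow.exists_doubling hρpos hmono
  refine ⟨8 ^ p * p.factorial * Real.exp 1, fun τ hτ r hr => ?_⟩
  have hs : Real.sqrt r ∈ Set.Ioc (0:ℝ) 1 :=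
    ⟨Real.sqrt_pos.2 hr.1, Real.sqrt_le_one.2 hr.2⟩
  have hx : τ ^ 2 / (8 * r) = (τ / Real.sqrt r) ^ 2 / 8 := by
    rw [div_pow, Real.sq_sqrt hr.1.le, div_div, mul_comm]
  have hle : ρ τ / ρ (Real.sqrt r) ≤ max 1 (2 * (τ / Real.sqrt r)) ^ p :=
    (div_le_iff₀ (hρpos _ hs)).2 (le_max_pow_mul_of_doubling hρpos hmono hp hs hτ)
  have hpow : (ρ τ / ρ (Real.sqrt r)) ^ θ ≤ max 1 (2 * (τ / Real.sqrt r)) ^ p :=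
    (Real.rpow_le_rpow (div_pos (hρpos _ hτ) (hρpos _ hs)).le hle hθ.1.le).trans
      (Real.rpow_le_self_of_one_le (one_le_pow₀ (le_max_left _ _)) hθ.2)
  rw [hx]
  exact (mul_le_mul_of_nonneg_left hpow (Real.exp_pos _).le).trans
    (exp_neg_sq_mul_max_pow_le p _)
end
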